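/- Let M be a measurable space, f : M → M a measurable map, μ an ergodic f-invariant probability measure on M, and r : M → ℝ a measurable roof function with r(x) ≥ r₀ for all x, where r₀ > 0 is a constant, and with ∫ r dμ < ∞. Then for μ-almost every x ∈ M and for every s with 0 ≤ s < r(x), the lap numbers satisfy n(x,s,T)/T → 1/(∫ r dμ) as T → ∞. -/

import Mathlib

open MeasureTheory Filter
open scoped Topology

/-- Birkhoff sum `S_n g(x) = ∑_{j=0}^{n-1} g(f^j x)`. -/
noncomputable def birkhoff {M : Type*} (f : M → M) (g : M → ℝ) (n : ℕ) (x : M) : ℝ :=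
  ∑ j ∈ Finset.range n, g (f^[j] x)

/-- The lap number `n(x,s,T)`: the largest `n` with `S_n r(x) ≤ s + T`. -/
noncomputable def lap {M : Type*} (f : M → M) (r : M → ℝ) (x : M) (s T : ℝ) : ℕ :=
  sSup {n : ℕ | birkhoff f r n x ≤ s + T}


/-- Running maxima of Birkhoff sums, defined recursively. -/
noncomputable def runMax {M : Type*} (f : M → M) (g : M → ℝ) : ℕ → M → ℝ
  | 0 => fun _ => 0
  | n + 1 => fun x => max 0 (g x + runMax f g n (f x))

lemma runMax_nonneg {M : Type*} (f : M → M) (g : M → ℝ) (n : ℕ) (x : M) :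
    0 ≤ runMax f g n x := by
  cases n with
  | zero => exact le_rfl
  | succ n => exact le_max_left _ _

lemma runMax_le_succ {M : Type*} (f : M → M) (g : M → ℝ) (n : ℕ) :
    ∀ x : M, runMax f g n x ≤ runMax f g (n + 1) x := by
  induction n with
  | zero => intro x; exact runMax_nonneg f g 1 x
  | succ n ih =>
    intro x
    exact max_le_max le_rfl (by have := ih (f x); linarith)

lemma birkhoff_succ_left {M : Type*} (f : M → M) (g : M → ℝ) (n : ℕ) (x : M) :
    birkhoff f g (n + 1) x = g x + birkhoff f g n (f x) := by
  unfold birkhoff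
  rw [Finset.sum_range_succ', add_comm]
  simp [Function.iterate_succ_apply]

lemma birkhoff_le_runMax {M : Type*} (f : M → M) (g : M → ℝ) (n : ℕ) :
    ∀ x : M, birkhoff f g n x ≤ runMax f g n x := by
  induction n with
  | zero => intro x; simp [birkhoff, runMax]
  | succ n ih =>
    intro x
    rw [birkhoff_succ_left]
    exact le_trans (by have := ih (f x); linarith) (le_max_right _ _)

lemma runMax_measurable {M : Type*} [MeasurableSpace M] {f : M → M} (hf : Measurable f)
    {g : M → ℝ} (hg : Measurable g) (n : ℕ) : Measurable (runMax f g n) := by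
  induction n with
  | zero => exact measurable_const
  | succ n ih => exact measurable_const.max (hg.add (ih.comp hf))

lemma runMax_integrable {M : Type*} [MeasurableSpace M] {f : M → M} {μ : Measure M}
    [IsProbabilityMeasure μ] (hf : MeasurePreserving f μ μ)
    {g : M → ℝ} (hg : Integrable g μ) (n : ℕ) : Integrable (runMax f g n) μ := by
  induction n with
  | zero => exact integrable_const 0
  | succ n ih =>
    exact (integrable_const (0 : ℝ)).sup (hg.add (hf.integrable_comp_of_integrable ih))

/-- The set of points with unbounded running maxima. -/
def unbddSet {M : Type*} (f : M → M) (g : M → ℝ) : Set M :=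
  {x | ¬ ∃ C : ℕ, ∀ n, runMax f g n x ≤ C}

lemma unbddSet_measurable {M : Type*} [MeasurableSpace M] {f : M → M} (hf : Measurable f)
    {g : M → ℝ} (hg : Measurable g) : MeasurableSet (unbddSet f g) := by
  have : unbddSet f g = (⋃ C : ℕ, ⋂ n, {x | runMax f g n x ≤ C})ᶜ := by
    ext x; simp [unbddSet]
  rw [this]
  exact (MeasurableSet.iUnion fun C => MeasurableSet.iInter fun n =>
    measurableSet_le (runMax_measurable hf hg n) measurable_const).compl

lemma unbddSet_invariant {M : Type*} (f : M → M) (g : M → ℝ) :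
    f ⁻¹' (unbddSet f g) = unbddSet f g := by
  ext x
  simp only [unbddSet, Set.mem_preimage, Set.mem_setOf_eq]
  apply not_congr
  constructor
  · rintro ⟨C, hC⟩
    obtain ⟨D, hD⟩ := exists_nat_ge (max 0 (g x + C))
    refine ⟨D, fun n => ?_⟩
    cases n with
    | zero => exact Nat.cast_nonneg _
    | succ n => exact le_trans (max_le_max le_rfl (by have := hC n; linarith)) hD
  · rintro ⟨C, hC⟩
    obtain ⟨D, hD⟩ := exists_nat_ge (C - g x)
    refine ⟨D, fun n => ?_⟩
    have h1 : g x + runMax f g n (f x) ≤ runMax f g (n + 1) x := le_max_right _ _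
    have := hC (n + 1)
    linarith

lemma birkhoff_bdd_of_integral_neg {M : Type*} [MeasurableSpace M]
    {f : M → M} {μ : Measure M} [IsProbabilityMeasure μ] (herg : Ergodic f μ)
    {g : M → ℝ} (hgm : Measurable g) (hgi : Integrable g μ) (hneg : ∫ x, g x ∂μ < 0) :
    ∀ᵐ x ∂μ, ∃ C : ℕ, ∀ n, birkhoff f g n x ≤ C := by
  have hf := herg.measurable
  have key : ∀ᵐ x ∂μ, x ∉ unbddSet f g := by
    rcases herg.toPreErgodic.ae_mem_or_ae_notMem (unbddSet_measurable hf hgm)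
      (unbddSet_invariant f g) with h | h
    swap
    · exact h
    exfalso
    have hmp := herg.toMeasurePreserving
    have hint := fun n => runMax_integrable hmp hgi n
    have hint' : ∀ n, Integrable (fun x => runMax f g n (f x)) μ := fun n =>
      hmp.integrable_comp_of_integrable (hint n)
    have hform : ∀ n x, runMax f g (n + 1) x - runMax f g n (f x)
        = max (-runMax f g n (f x)) (g x) := by
      intro n x
      change max 0 (g x + runMax f g n (f x)) - _ = _
      rw [← max_sub_sub_right]; simp
    have hlim : Tendsto (fun n => ∫ x, (runMax f g (n + 1) x - runMax f g n (f x)) ∂μ) atTop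
        (𝓝 (∫ x, g x ∂μ)) := by
      refine tendsto_integral_of_dominated_convergence (fun x => |g x|) ?_ hgi.abs ?_ ?_
      · exact fun n => ((hint (n + 1)).sub (hint' n)).aestronglyMeasurable
      · intro n
        refine Eventually.of_forall fun x => ?_
        rw [hform, Real.norm_eq_abs, abs_le]
        have := runMax_nonneg f g n (f x)
        exact ⟨(neg_abs_le _).trans (le_max_right _ _),
          max_le (by have := abs_nonneg (g x); linarith) (le_abs_self _)⟩
      · filter_upwards [h] with x hx
        rw [← unbddSet_invariant] at hx
        simp only [unbddSet, Set.mem_preimage, Set.mem_setOf_eq] at hx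
        push Not at hx
        obtain ⟨D, hD⟩ := exists_nat_ge (-g x)
        obtain ⟨N, hN⟩ := hx D
        refine tendsto_const_nhds.congr' ?_
        filter_upwards [eventually_ge_atTop N] with n hn
        have hmono : Monotone fun n => runMax f g n (f x) :=
          monotone_nat_of_le_succ fun n => runMax_le_succ f g n (f x)
        have := hmono hn
        simp only at this
        rw [hform, max_eq_right]
        linarith
    have hge : 0 ≤ ∫ x, g x ∂μ := by
      refine ge_of_tendsto' hlim fun n => ?_
      rw [integral_sub (hint (n + 1)) (hint' n)]
      have h1 : ∫ x, runMax f g n (f x) ∂μ = ∫ x, runMax f g n x ∂μ := by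
        have h2 := integral_map (μ := μ) hf.aemeasurable (f := runMax f g n)
          (by rw [hmp.map_eq]; exact (hint n).aestronglyMeasurable)
        rw [hmp.map_eq] at h2
        exact h2.symm
      rw [h1, sub_nonneg]
      exact integral_mono (hint n) (hint (n + 1)) (runMax_le_succ f g n)
    linarith
  filter_upwards [key] with x hx
  simp only [unbddSet, Set.mem_setOf_eq, not_not] at hx
  obtain ⟨C, hC⟩ := hx
  exact ⟨C, fun n => (birkhoff_le_runMax f g n x).trans (hC n)⟩

lemma birkhoff_upper {M : Type*} [MeasurableSpace M]
    {f : M → M} {μ : Measure M} [IsProbabilityMeasure μ] (herg : Ergodic f μ)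
    {g : M → ℝ} (hgm : Measurable g) (hgi : Integrable g μ) :
    ∀ᵐ x ∂μ, ∀ k : ℕ, ∃ C : ℕ, ∀ n : ℕ,
      birkhoff f g n x ≤ n * (∫ x, g x ∂μ + 1 / ((k : ℝ) + 1)) + C := by
  rw [ae_all_iff]
  intro k
  set c := ∫ x, g x ∂μ + 1 / ((k : ℝ) + 1) with hc
  have hpos : 0 < 1 / ((k : ℝ) + 1) := Nat.one_div_pos_of_nat
  have hneg : ∫ x, (g x - c) ∂μ < 0 := by
    rw [integral_sub hgi (integrable_const _)]
    simp; linarith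
  filter_upwards [birkhoff_bdd_of_integral_neg herg (hgm.sub measurable_const)
    (hgi.sub (integrable_const c)) hneg] with x hx
  obtain ⟨C, hC⟩ := hx
  refine ⟨C, fun n => ?_⟩
  have := hC n
  simp only [birkhoff, Pi.sub_apply, Finset.sum_sub_distrib, Finset.sum_const,
    Finset.card_range, nsmul_eq_mul] at this
  unfold birkhoff
  linarith

/-- Birkhoff's pointwise ergodic theorem (ergodic case). -/
lemma birkhoff_tendsto {M : Type*} [MeasurableSpace M]
    {f : M → M} {μ : Measure M} [IsProbabilityMeasure μ] (herg : Ergodic f μ)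
    {g : M → ℝ} (hgm : Measurable g) (hgi : Integrable g μ) :
    ∀ᵐ x ∂μ, Tendsto (fun n : ℕ => birkhoff f g n x / n) atTop (𝓝 (∫ x, g x ∂μ)) := by
  filter_upwards [birkhoff_upper herg hgm hgi, birkhoff_upper herg hgm.neg hgi.neg] with x h1 h2
  rw [Metric.tendsto_atTop]
  intro ε hε
  obtain ⟨k, hk⟩ := exists_nat_one_div_lt (half_pos hε)
  obtain ⟨C, hC⟩ := h1 k
  obtain ⟨D, hD⟩ := h2 k
  obtain ⟨N, hN⟩ := exists_nat_gt ((C + D) / (ε / 2))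
  refine ⟨N + 1, fun n hn => ?_⟩
  have hn' : (N : ℝ) + 1 ≤ n := by exact_mod_cast hn
  have hn0 : (0 : ℝ) < n := by have : (0 : ℝ) ≤ N := Nat.cast_nonneg _; linarith
  have hCD : (C : ℝ) + D < n * (ε / 2) := by
    rw [div_lt_iff₀ (half_pos hε)] at hN
    nlinarith
  have hC0 : (0 : ℝ) ≤ C := Nat.cast_nonneg _
  have hD0 : (0 : ℝ) ≤ D := Nat.cast_nonneg _
  have a1 := hC n
  have a2 := hD n
  have a3 : birkhoff f (-g) n x = - birkhoff f g n x := by simp [birkhoff]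
  have a4 : ∫ x, (-g) x ∂μ = - ∫ x, g x ∂μ := by
    simp only [Pi.neg_apply]; exact integral_neg _
  rw [a3, a4] at a2
  have a5 : (n : ℝ) * (1 / ((k : ℝ) + 1)) < n * (ε / 2) := mul_lt_mul_of_pos_left hk hn0
  rw [Real.dist_eq, abs_lt]
  constructor
  · rw [lt_sub_iff_add_lt, lt_div_iff₀ hn0]
    linarith
  · rw [sub_lt_iff_lt_add, div_lt_iff₀ hn0]
    linarith

lemma lap_spec {M : Type*} (f : M → M) (r : M → ℝ) (r₀ : ℝ) (hr₀ : 0 < r₀)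
    (hr : ∀ x, r₀ ≤ r x) (x : M) (s T : ℝ) (h : 0 ≤ s + T) :
    birkhoff f r (lap f r x s T) x ≤ s + T ∧
      (∀ n, birkhoff f r n x ≤ s + T → n ≤ lap f r x s T) := by
  have hb : BddAbove {n : ℕ | birkhoff f r n x ≤ s + T} := by
    obtain ⟨N, hN⟩ := exists_nat_ge ((s + T) / r₀)
    refine ⟨N, fun n hn => ?_⟩
    have h1 : (n : ℝ) * r₀ ≤ birkhoff f r n x := by
      have := Finset.card_nsmul_le_sum (Finset.range n) (fun j => r (f^[j] x)) r₀
        (fun j _ => hr _)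
      simpa [birkhoff] using this
    have h2 : birkhoff f r n x ≤ s + T := hn
    have h3 : (n : ℝ) ≤ (s + T) / r₀ := by
      rw [le_div_iff₀ hr₀]; linarith
    exact_mod_cast h3.trans hN
  refine ⟨Nat.sSup_mem (s := {n : ℕ | birkhoff f r n x ≤ s + T}) ⟨0, ?_⟩ hb,
    fun n hn => le_csSup hb hn⟩
  simpa [birkhoff] using h

theorem lap_number_asymptotics {M : Type*} [MeasurableSpace M]
    (f : M → M) (hf : Measurable f) (μ : Measure M) [IsProbabilityMeasure μ]
    (herg : Ergodic f μ)
    (r : M → ℝ) (hrm : Measurable r) (r₀ : ℝ) (hr₀ : 0 < r₀) (hr : ∀ x, r₀ ≤ r x)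
    (hri : Integrable r μ) :
    ∀ᵐ x ∂μ, ∀ s : ℝ, 0 ≤ s → s < r x →
      Tendsto (fun T : ℝ => (lap f r x s T : ℝ) / T) atTop
        (𝓝 (1 / ∫ x, r x ∂μ)) := by
  have hc : 0 < ∫ x, r x ∂μ := by
    have : ∫ _x, r₀ ∂μ ≤ ∫ x, r x ∂μ := integral_mono (integrable_const _) hri hr
    simp at this
    linarith
  filter_upwards [birkhoff_tendsto herg hrm hri] with x hx s hs0 _
  set c := ∫ x, r x ∂μ
  have hlap : Tendsto (fun T : ℝ => lap f r x s T) atTop atTop := by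
    rw [tendsto_atTop]
    intro N
    filter_upwards [eventually_ge_atTop (max 0 (birkhoff f r N x))] with T hT
    have h1 := le_trans (le_max_left _ _) hT
    have h2 := le_trans (le_max_right _ _) hT
    exact (lap_spec f r r₀ hr₀ hr x s T (by linarith)).2 N (by linarith)
  have hinv : Tendsto (fun n : ℕ => s / (n : ℝ)) atTop (𝓝 0) :=
    tendsto_const_div_atTop_nhds_zero_nat s
  have hlow : Tendsto (fun n : ℕ => birkhoff f r n x / n - s / n) atTop (𝓝 c) := by
    simpa using hx.sub hinv
  have hup : Tendsto (fun n : ℕ => birkhoff f r (n + 1) x / ((n + 1 : ℕ) : ℝ)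
      * (1 + 1 / (n : ℝ)) - s / n) atTop (𝓝 c) := by
    have h1 := (hx.comp (tendsto_add_atTop_nat 1)).mul
      ((tendsto_const_div_atTop_nhds_zero_nat (1 : ℝ)).const_add 1)
    simpa using h1.sub hinv
  have hmain : Tendsto (fun T : ℝ => T / (lap f r x s T : ℝ)) atTop (𝓝 c) := by
    refine tendsto_of_tendsto_of_tendsto_of_le_of_le' (hlow.comp hlap) (hup.comp hlap) ?_ ?_
    · filter_upwards [eventually_ge_atTop 0, hlap.eventually_ge_atTop 1] with T hT hn
      have hn0 : (0 : ℝ) < (lap f r x s T : ℝ) := by exact_mod_cast hn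
      have h1 := (lap_spec f r r₀ hr₀ hr x s T (by linarith)).1
      simp only [Function.comp]
      rw [← sub_div]
      exact div_le_div_of_nonneg_right (by linarith) hn0.le
    · filter_upwards [eventually_ge_atTop 0, hlap.eventually_ge_atTop 1] with T hT hn
      have hn0 : (0 : ℝ) < (lap f r x s T : ℝ) := by exact_mod_cast hn
      have h1 : s + T < birkhoff f r (lap f r x s T + 1) x := by
        by_contra! hcon
        have := (lap_spec f r r₀ hr₀ hr x s T (by linarith)).2 _ hcon
        omega
      simp only [Function.comp]
      have h2 : birkhoff f r (lap f r x s T + 1) x / ((lap f r x s T + 1 : ℕ) : ℝ)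
          * (1 + 1 / (lap f r x s T : ℝ)) - s / (lap f r x s T : ℝ)
          = (birkhoff f r (lap f r x s T + 1) x - s) / (lap f r x s T : ℝ) := by
        push_cast
        field_simp
      rw [h2]
      exact div_le_div_of_nonneg_right (by linarith) hn0.le
  have := hmain.inv₀ hc.ne'
  simpa using this
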